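/- Let g ≥ 1 and P, Q, Z ∈ ℂ^g, and let C = C(P) be the companion matrix of p(x) = x^g − Σ_{k=1}^g P_k x^{k−1}. Define Z₁ = (Σ_{k=1}^g Q_k C^{k−1}) Q − C^g (C P + Z) ∈ ℂ^g. Then for every root ξ ∈ ℂ of p, setting η = Σ_{k=1}^g Q_k ξ^{k−1}, one has η² = ξ^{2g+1} + Σ_{k=1}^g Z_k ξ^{g+k−1} + Σ_{k=1}^g (Z₁)_k ξ^{k−1}; that is, the point (ξ, η) lies on the hyperelliptic curve y² = x^{2g+1} + Σ_{k=1}^g Z_k x^{g+k−1} + Σ_{k=1}^g (Z₁)_k x^{k−1}. -/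

import Mathlib

open Matrix

/-- The companion matrix of the polynomial `x^g - ∑_{k=1}^g P_k x^{k-1}`
(0-indexed: entries `C i j = (1 if j+1 = i else 0) + (P i if j = g-1 else 0)`). -/
noncomputable def companionMat (g : ℕ) (P : Fin g → ℂ) : Matrix (Fin g) (Fin g) ℂ :=
  fun i j => (if (j : ℕ) + 1 = (i : ℕ) then 1 else 0) + (if (j : ℕ) = g - 1 then P i else 0)

theorem vec_companion (g : ℕ) (P : Fin g → ℂ) (ξ : ℂ)
    (hroot : ξ ^ g = ∑ k : Fin g, P k * ξ ^ (k : ℕ)) :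
    (fun k : Fin g => ξ ^ (k : ℕ)) ᵥ* companionMat g P = ξ • (fun k : Fin g => ξ ^ (k : ℕ)) := by
  funext j
  have hj := j.isLt
  simp only [Matrix.vecMul, dotProduct, companionMat, Pi.smul_apply, smul_eq_mul, mul_add,
    Finset.sum_add_distrib]
  by_cases h : (j : ℕ) = g - 1
  · have h1 : ∑ x : Fin g, ξ ^ (x : ℕ) * (if (j : ℕ) + 1 = (x : ℕ) then (1 : ℂ) else 0) = 0 := by
      apply Finset.sum_eq_zero
      intro x _
      have hx := x.isLt
      rw [if_neg (by omega), mul_zero]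
    rw [h1, zero_add]
    simp only [if_pos h]
    rw [← pow_succ', show (j : ℕ) + 1 = g by omega, hroot]
    exact Finset.sum_congr rfl fun x _ => mul_comm _ _
  · simp only [if_neg h, mul_zero, Finset.sum_const_zero, add_zero]
    rw [Finset.sum_eq_single (⟨(j : ℕ) + 1, by omega⟩ : Fin g)]
    · simp [pow_succ']
    · intro b _ hb
      rw [if_neg, mul_zero]
      intro hc
      exact hb (Fin.ext hc.symm)
    · simp

theorem vec_pow {g : ℕ} (C : Matrix (Fin g) (Fin g) ℂ) (v : Fin g → ℂ) (ξ : ℂ)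
    (h : v ᵥ* C = ξ • v) (n : ℕ) : v ᵥ* (C ^ n) = ξ ^ n • v := by
  induction n with
  | zero => simp
  | succ n ih => rw [pow_succ, ← Matrix.vecMul_vecMul, ih, Matrix.smul_vecMul, h, smul_smul, pow_succ]

theorem anchor_map_over_property (g : ℕ) (hg : 1 ≤ g) (P Q Z : Fin g → ℂ)
    (C : Matrix (Fin g) (Fin g) ℂ) (hC : C = companionMat g P)
    (Z₁ : Fin g → ℂ)
    (hZ₁ : Z₁ = (∑ k : Fin g, Q k • C ^ (k : ℕ)).mulVec Q
        - (C ^ g).mulVec (C.mulVec P + Z))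
    (ξ : ℂ) (hroot : ξ ^ g = ∑ k : Fin g, P k * ξ ^ (k : ℕ))
    (η : ℂ) (hη : η = ∑ k : Fin g, Q k * ξ ^ (k : ℕ)) :
    η ^ 2 = ξ ^ (2 * g + 1) + (∑ k : Fin g, Z k * ξ ^ (g + (k : ℕ)))
      + ∑ k : Fin g, Z₁ k * ξ ^ (k : ℕ) := by
  obtain ⟨v, hv⟩ : ∃ v : Fin g → ℂ, v = fun k : Fin g => ξ ^ (k : ℕ) := ⟨_, rfl⟩
  have hvC : v ᵥ* C = ξ • v := by rw [hv, hC]; exact vec_companion g P ξ hroot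
  have key : ∀ w : Fin g → ℂ, ∑ k : Fin g, w k * ξ ^ (k : ℕ) = v ⬝ᵥ w := by
    intro w
    rw [hv]
    exact Finset.sum_congr rfl fun x _ => mul_comm _ _
  have hZ : ∑ k : Fin g, Z k * ξ ^ (g + (k : ℕ)) = ξ ^ g * (v ⬝ᵥ Z) := by
    rw [← key, Finset.mul_sum]
    refine Finset.sum_congr rfl fun x _ => ?_
    rw [pow_add]; ring
  have hS : v ᵥ* (∑ k : Fin g, Q k • C ^ (k : ℕ)) = η • v := by
    rw [Matrix.vecMul_sum, hη, Finset.sum_smul]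
    refine Finset.sum_congr rfl fun x _ => ?_
    rw [Matrix.vecMul_smul, vec_pow C v ξ hvC, smul_smul]
  rw [hZ, key, hZ₁, dotProduct_sub, Matrix.dotProduct_mulVec, Matrix.dotProduct_mulVec, hS,
    vec_pow C v ξ hvC, smul_dotProduct, smul_dotProduct, dotProduct_add,
    Matrix.dotProduct_mulVec, hvC, smul_dotProduct, ← key Q, ← key P, ← hη, ← hroot]
  simp only [smul_eq_mul]
  ring
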